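/- Suppose there is an integer α ≥ 1 such that dim_K V(2^m) = 1 for all m ≥ α, and let c be a natural number such that dim_K ( Σ_{i=0}^{n} V^<(i) V^>(n−i) ) ≤ c for all n ≥ 0. Let β be a natural number with β > 2^α (c+1). Then for every n ≥ 1, all monomials m_1, …, m_β of degree n in A, and all monomials r_1, …, r_β in A, one has d_β(m_1, …, m_β; r_1, …, r_β) ∈ E. -/

import Mathlib

/-
Formalization of statements from:
"Golod-Shafarevich algebras of a reduced number of defining relations" (A. Smoktunowicz).

`FA K` is the free associative unital `K`-algebra `A = K⟨x,y⟩` on two generators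
(`FreeAlgebra.ι K 0` and `FreeAlgebra.ι K 1`), graded with the generators in degree 1.
-/

open scoped Pointwise Classical

noncomputable section

/-- The free associative unital `K`-algebra on two generators. -/
abbrev FA (K : Type) [Field K] : Type := FreeAlgebra K (Fin 2)

variable (K : Type) [Field K]

/-- The set of monomials of degree `k` in the free algebra on two generators. -/
def Mon (k : ℕ) : Set (FA K) :=
  { m | ∃ w : List (Fin 2), w.length = k ∧ m = (w.map (FreeAlgebra.ι K)).prod }

/-- `Adeg K k` is the `k`-th homogeneous component `A(k)`: the span of the monomials of
degree `k`. -/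
def Adeg (k : ℕ) : Submodule K (FA K) :=
  Submodule.span K (Mon K k)

/-- Properties (1)-(4) of the families `U(2^m)`, `V(2^m)` of subspaces of `A(2^m)`
(Section 1 of the paper):
(1) `V(2^m)` is spanned by monomials (of degree `2^m`);
(2) `V(2^m) + U(2^m) = A(2^m)` and `V(2^m) ∩ U(2^m) = 0`;
(3) `A(2^{m-1})U(2^{m-1}) + U(2^{m-1})A(2^{m-1}) ⊆ U(2^m)`;
(4) `V(2^m) ⊆ V(2^{m-1})V(2^{m-1})`;
with `V(2^0) = Kx + Ky` and `U(2^0) = 0`. -/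
def UVCond (U V : ℕ → Submodule K (FA K)) : Prop :=
  V 0 = Submodule.span K {FreeAlgebra.ι K 0, FreeAlgebra.ι K 1} ∧
  U 0 = ⊥ ∧
  ∀ m : ℕ, 1 ≤ m →
    (∃ s ⊆ Mon K (2 ^ m), V m = Submodule.span K s) ∧
    U m ≤ Adeg K (2 ^ m) ∧
    V m ⊔ U m = Adeg K (2 ^ m) ∧
    V m ⊓ U m = ⊥ ∧
    Adeg K (2 ^ (m - 1)) * U (m - 1) ⊔ U (m - 1) * Adeg K (2 ^ (m - 1)) ≤ U m ∧
    V m ≤ V (m - 1) * V (m - 1)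

/-- The homogeneous component `E(k)` (as a set), for `k ≥ 1`.  For the unique `n` with
`2^(n-1) ≤ k < 2^n` (i.e. `n = Nat.log 2 k + 1`) it consists of those `r ∈ A(k)` with
`A r A ∩ A(2^(n+1)) ⊆ U(2^n)A(2^n) + A(2^n)U(2^n)`; here `A r A` is the two-sided ideal
generated by `r`, realized as the subspace `⊤ * span{r} * ⊤`. -/
def ESet (U : ℕ → Submodule K (FA K)) (k : ℕ) : Set (FA K) :=
  { r | r ∈ Adeg K k ∧
    (⊤ : Submodule K (FA K)) * Submodule.span K {r} * ⊤ ⊓ Adeg K (2 ^ (Nat.log 2 k + 2)) ≤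
      U (Nat.log 2 k + 1) * Adeg K (2 ^ (Nat.log 2 k + 1)) ⊔
        Adeg K (2 ^ (Nat.log 2 k + 1)) * U (Nat.log 2 k + 1) }

/-- The graded subspace `E = ⊕_{k ≥ 1} E(k)` (each `E(k)` is a subspace, so the span of the
union of the `E(k)` is their direct sum). -/
def Esub (U : ℕ → Submodule K (FA K)) : Submodule K (FA K) :=
  Submodule.span K (⋃ k ∈ Set.Ici 1, ESet K U k)

/-- Auxiliary: the product of the `V(2^p)` over the set bits of `k`, lowest bit first,
with bit positions shifted by `i`. -/
def prodLow (V : ℕ → Submodule K (FA K)) (i k : ℕ) : Submodule K (FA K) :=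
  if _h : k = 0 then 1
  else (if k % 2 = 1 then V i else 1) * prodLow V (i + 1) (k / 2)
termination_by k
decreasing_by exact Nat.div_lt_self (Nat.pos_of_ne_zero _h) one_lt_two

/-- Auxiliary: the product of the `V(2^p)` over the set bits of `k`, highest bit first. -/
def prodHigh (V : ℕ → Submodule K (FA K)) (i k : ℕ) : Submodule K (FA K) :=
  if _h : k = 0 then 1
  else prodHigh V (i + 1) (k / 2) * (if k % 2 = 1 then V i else 1)
termination_by k
decreasing_by exact Nat.div_lt_self (Nat.pos_of_ne_zero _h) one_lt_two

/-- `V^<(k) = V(2^{p_1}) ⋯ V(2^{p_t})` where `k = 2^{p_1} + ⋯ + 2^{p_t}` in binary with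
`p_1 < ⋯ < p_t`; `V^<(0) = K·1`. -/
def Vlt (V : ℕ → Submodule K (FA K)) (k : ℕ) : Submodule K (FA K) := prodLow K V 0 k

/-- `V^>(k) = V(2^{p_t}) ⋯ V(2^{p_1})`; `V^>(0) = K·1`. -/
def Vgt (V : ℕ → Submodule K (FA K)) (k : ℕ) : Submodule K (FA K) := prodHigh K V 0 k

/-- `U^<(k) = Σ_i A(2^{p_1}+⋯+2^{p_{i-1}}) U(2^{p_i}) A(2^{p_{i+1}}+⋯+2^{p_t})`
(for each set bit `p_i` of `k`, the lower part of `k` is `k % 2^{p_i}` and the upper part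
is `k - k % 2^{p_i} - 2^{p_i}`); `U^<(0) = 0`. -/
def Ult (U : ℕ → Submodule K (FA K)) (k : ℕ) : Submodule K (FA K) :=
  ⨆ (p : ℕ) (_ : k.testBit p),
    Adeg K (k % 2 ^ p) * U p * Adeg K (k - k % 2 ^ p - 2 ^ p)

/-- `U^>(k) = Σ_i A(2^{p_t}+⋯+2^{p_{i+1}}) U(2^{p_i}) A(2^{p_{i-1}}+⋯+2^{p_1})`;
`U^>(0) = 0`. -/
def Ugt (U : ℕ → Submodule K (FA K)) (k : ℕ) : Submodule K (FA K) :=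
  ⨆ (p : ℕ) (_ : k.testBit p),
    Adeg K (k - k % 2 ^ p - 2 ^ p) * U p * Adeg K (k % 2 ^ p)

/-- The Capelli polynomial
`d_n(x_1,…,x_n; y_1,…,y_n) = Σ_{σ ∈ Sym(n)} sgn(σ) x_{σ(1)} y_1 x_{σ(2)} y_2 ⋯ x_{σ(n)} y_n`,
evaluated in a ring. -/
def capelli {R : Type*} [Ring R] (n : ℕ) (x y : Fin n → R) : R :=
  ∑ σ : Equiv.Perm (Fin n),
    (Equiv.Perm.sign σ : ℤ) • ((List.finRange n).map fun i => x (σ i) * y i).prod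

/-- The quotient map `R → R ⧸ c` (for a ring congruence `c`) as a `K`-linear map. -/
def mkLin {R : Type*} [Semiring R] [Algebra K R] (c : RingCon R) :
    R →ₗ[K] c.Quotient where
  toFun := RingCon.toQuotient
  map_add' _ _ := rfl
  map_smul' _ _ := rfl

/-- A two-sided ideal of the free algebra is homogeneous iff it is spanned by its
homogeneous elements. -/
def IsHomogTSI (J : TwoSidedIdeal (FA K)) : Prop :=
  (J : Set (FA K)) ⊆ ↑(Submodule.span K {a : FA K | a ∈ J ∧ ∃ n, a ∈ Adeg K n})

/-- `S = ⋃_{n ∈ Y} {n - e(n) - 1, …, n - 1}`. -/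
def SetS (Y : Set ℕ) (e : ℕ → ℕ) : Set ℕ :=
  ⋃ n ∈ Y, Set.Icc (n - e n - 1) (n - 1)

/-- Conditions (1)-(8) of Theorem 4.1 of the paper, at index `m`, for the families
`F(2^m)`, `U(2^m)`, `V(2^m)` of subspaces of `A(2^m)`:
(1) `dim V(2^m) = 2` if `m ∉ S` and (in case `Y` is finite) `m ≤ max Y`;
(2) `dim V(2^{k-e(k)-1+j}) = 2^{2^j}` for all `k ∈ Y` and `0 ≤ j ≤ e(k)`;
(3) `V(2^m)` is spanned by monomials;
(4) `F(2^m) ⊆ U(2^m)` for `m ∈ Y`, and `F(2^m) = 0` for `m ∉ Y`;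
(5) `V(2^m) ⊕ U(2^m) = A(2^m)`;
(6) `A(2^{m-1})U(2^{m-1}) + U(2^{m-1})A(2^{m-1}) ⊆ U(2^m)`;
(7) `V(2^m) ⊆ V(2^{m-1})V(2^{m-1})`;
(8) if `Y` is finite and `m > max Y`, then `dim V(2^m) = 1`. -/
def Conds (Y : Set ℕ) (e : ℕ → ℕ) (F U V : ℕ → Submodule K (FA K)) (m : ℕ) : Prop :=
  (m ∉ SetS Y e → (Y.Finite → ∃ k ∈ Y, m ≤ k) → Module.finrank K (V m) = 2) ∧
  (∀ k ∈ Y, ∀ j ≤ e k, k - e k - 1 + j = m → Module.finrank K (V m) = 2 ^ 2 ^ j) ∧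
  (∃ s ⊆ Mon K (2 ^ m), V m = Submodule.span K s) ∧
  (m ∈ Y → F m ≤ U m) ∧ (m ∉ Y → F m = ⊥) ∧
  U m ≤ Adeg K (2 ^ m) ∧
  V m ⊔ U m = Adeg K (2 ^ m) ∧ V m ⊓ U m = ⊥ ∧
  (Adeg K (2 ^ (m - 1)) * U (m - 1) ⊔ U (m - 1) * Adeg K (2 ^ (m - 1)) ≤ U m) ∧
  V m ≤ V (m - 1) * V (m - 1) ∧
  (Y.Finite → (∀ k ∈ Y, k < m) → Module.finrank K (V m) = 1)

theorem Mon_mul (a b : ℕ) : Mon K a * Mon K b = Mon K (a + b) := by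
  ext z
  constructor
  · rintro ⟨_, ⟨w, rfl, rfl⟩, _, ⟨w', rfl, rfl⟩, rfl⟩
    exact ⟨w ++ w', by simp, by simp⟩
  · rintro ⟨w, hw, rfl⟩
    refine ⟨_, ⟨w.take a, by simp [hw], rfl⟩, _, ⟨w.drop a, by simp [hw], rfl⟩, ?_⟩
    change _ * _ = _
    rw [← List.prod_append, ← List.map_append, List.take_append_drop]

theorem Adeg_mul (a b : ℕ) : Adeg K a * Adeg K b = Adeg K (a + b) := by
  rw [Adeg, Adeg, Submodule.span_mul_span, Mon_mul, Adeg]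

theorem Adeg_zero : Adeg K 0 = 1 := by
  have : Mon K 0 = {1} := by
    ext z
    constructor
    · rintro ⟨w, hw, rfl⟩
      simp [List.length_eq_zero_iff.mp hw]
    · rintro rfl
      exact ⟨[], rfl, by simp⟩
  rw [Adeg, this, Submodule.one_eq_span]

theorem Adeg_one : Adeg K 1 = Submodule.span K {FreeAlgebra.ι K 0, FreeAlgebra.ι K 1} := by
  have : Mon K 1 = {FreeAlgebra.ι K 0, FreeAlgebra.ι K 1} := by
    ext z
    constructor
    · rintro ⟨w, hw, rfl⟩
      obtain ⟨i, rfl⟩ := List.length_eq_one_iff.mp hw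
      fin_cases i <;> simp
    · rintro (rfl | rfl)
      · exact ⟨[0], rfl, by simp⟩
      · exact ⟨[1], rfl, by simp⟩
  rw [Adeg, this]

section

variable {K}

theorem mul_mem_Adeg {a b : ℕ} {x y : FA K} (hx : x ∈ Adeg K a) (hy : y ∈ Adeg K b) :
    x * y ∈ Adeg K (a + b) :=
  Adeg_mul K a b ▸ Submodule.mul_mem_mul hx hy

theorem list_prod_mem_Adeg {ι : Type*} (l : List ι) (f : ι → FA K) (g : ι → ℕ)
    (h : ∀ i, f i ∈ Adeg K (g i)) : (l.map f).prod ∈ Adeg K (l.map g).sum := by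
  induction l with
  | nil => simp [Adeg_zero]
  | cons i l ih => simpa using mul_mem_Adeg (h i) ih

theorem span_iUnion_Mon : Submodule.span K (⋃ k, Mon K k) = ⊤ := by
  rw [eq_top_iff, ← Algebra.top_toSubmodule, ← FreeAlgebra.adjoin_range_ι,
    Algebra.adjoin_eq_span]
  refine Submodule.span_mono fun z hz => ?_
  induction hz using Submonoid.closure_induction with
  | mem z hz =>
    obtain ⟨i, rfl⟩ := hz
    exact Set.mem_iUnion.2 ⟨1, [i], rfl, by simp⟩
  | one => exact Set.mem_iUnion.2 ⟨0, [], rfl, by simp⟩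
  | mul x y _ _ hx hy =>
    obtain ⟨a, ha⟩ := Set.mem_iUnion.1 hx
    obtain ⟨b, hb⟩ := Set.mem_iUnion.1 hy
    exact Set.mem_iUnion.2 ⟨a + b, Mon_mul K a b ▸ Set.mul_mem_mul ha hb⟩

variable (K) in
/-- The algebra homomorphism sending a homogeneous element `z` of degree `k` to `z X^k`. -/
def gradingHom : FA K →ₐ[K] Polynomial (FA K) :=
  FreeAlgebra.lift K fun i => Polynomial.monomial 1 (FreeAlgebra.ι K i)

theorem gradingHom_of_mem_Adeg {k : ℕ} {z : FA K} (hz : z ∈ Adeg K k) :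
    gradingHom K z = Polynomial.monomial k z := by
  induction hz using Submodule.span_induction with
  | mem z hz =>
    obtain ⟨w, rfl, rfl⟩ := hz
    induction w with
    | nil => simp
    | cons i w ih =>
      rw [List.map_cons, List.prod_cons, map_mul, ih, gradingHom, FreeAlgebra.lift_ι_apply,
        Polynomial.monomial_mul_monomial, List.length_cons, add_comm]
  | zero => simp
  | add x y _ _ hx hy => simp [hx, hy]
  | smul a x _ hx => rw [map_smul, hx, Polynomial.smul_monomial]

variable (K) in
/-- The projection of the free algebra onto its homogeneous component of degree `k`. -/
def homogComponent (k : ℕ) : FA K →ₗ[K] FA K :=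
  ((Polynomial.lcoeff (FA K) k).restrictScalars K) ∘ₗ (gradingHom K).toLinearMap

theorem homogComponent_of_mem_Adeg {k l : ℕ} {z : FA K} (hz : z ∈ Adeg K l) :
    homogComponent K k z = if l = k then z else 0 := by
  simp [homogComponent, gradingHom_of_mem_Adeg hz, Polynomial.coeff_monomial]

/-- The part of degree `L` of the ideal generated by a homogeneous element `d` is spanned by the
products `u d v` with `u`, `v` monomials of the appropriate degrees. -/
theorem ideal_inf_Adeg_le {D L : ℕ} {d : FA K} (hd : d ∈ Adeg K D) (W : Submodule K (FA K))
    (h : ∀ P Q : ℕ, P + D + Q = L → ∀ u ∈ Mon K P, ∀ v ∈ Mon K Q, u * d * v ∈ W) :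
    (⊤ : Submodule K (FA K)) * Submodule.span K {d} * ⊤ ⊓ Adeg K L ≤ W := by
  rintro z ⟨hz, hzL⟩
  have key : (⊤ : Submodule K (FA K)) * Submodule.span K {d} * ⊤ ≤
      W.comap (homogComponent K L) := by
    rw [← span_iUnion_Mon, Submodule.span_mul_span, Submodule.span_mul_span, Submodule.span_le]
    rintro _ ⟨_, ⟨u, hu, _, rfl, rfl⟩, v, hv, rfl⟩
    obtain ⟨P, hu⟩ := Set.mem_iUnion.1 hu
    obtain ⟨Q, hv⟩ := Set.mem_iUnion.1 hv
    change homogComponent K L (u * _ * v) ∈ W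
    rw [homogComponent_of_mem_Adeg
      (mul_mem_Adeg (mul_mem_Adeg (Submodule.subset_span hu) hd) (Submodule.subset_span hv))]
    split_ifs with hL
    · exact h P Q hL u hu v hv
    · exact W.zero_mem
  have := key hz
  rwa [Submodule.mem_comap, homogComponent_of_mem_Adeg hzL, if_pos rfl] at this

theorem UVCond.sup_eq {U V : ℕ → Submodule K (FA K)} (hUV : UVCond K U V) (p : ℕ) :
    V p ⊔ U p = Adeg K (2 ^ p) := by
  obtain rfl | hp := Nat.eq_zero_or_pos p
  · rw [hUV.1, hUV.2.1, sup_bot_eq, pow_zero, Adeg_one]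
  · exact (hUV.2.2 p hp).2.2.1

/-- Once the spaces `V(2^p)` are lines, `U(2^(p+1))` is determined by `U(2^p)`. -/
theorem UVCond.U_succ_le {U V : ℕ → Submodule K (FA K)} (hUV : UVCond K U V) {p : ℕ}
    (h₁ : Module.finrank K (V p) = 1) (h₂ : Module.finrank K (V (p + 1)) = 1) :
    U (p + 1) ≤ Adeg K (2 ^ p) * U p ⊔ U p * Adeg K (2 ^ p) := by
  obtain ⟨-, hUA, -, hdisj, hU, hV⟩ := hUV.2.2 (p + 1) (Nat.succ_pos p)
  rw [Nat.add_sub_cancel] at hU hV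
  have hsup := hUV.sup_eq p
  have hVV : V p * V p ≤ V (p + 1) := by
    obtain ⟨⟨v, hv⟩, -, hspan⟩ := finrank_eq_one_iff'.1 h₁
    have hle : V p * V p ≤ Submodule.span K {v * v} := by
      rw [Submodule.mul_le]
      intro a ha b hb
      obtain ⟨s, hs⟩ := hspan ⟨a, ha⟩
      obtain ⟨t, ht⟩ := hspan ⟨b, hb⟩
      obtain rfl : s • v = a := congrArg Subtype.val hs
      obtain rfl : t • v = b := congrArg Subtype.val ht
      rw [smul_mul_smul_comm]
      exact Submodule.smul_mem _ _ (Submodule.mem_span_singleton_self _)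
    have : FiniteDimensional K (Submodule.span K {v * v}) :=
      FiniteDimensional.span_singleton K _
    have heq : V (p + 1) = Submodule.span K {v * v} :=
      Submodule.eq_of_le_of_finrank_le (hV.trans hle) (by
        rw [h₂]
        exact (finrank_span_le_card ({v * v} : Set (FA K))).trans (by simp))
    exact heq ▸ hle
  have hA : Adeg K (2 ^ (p + 1)) ≤
      V (p + 1) ⊔ (Adeg K (2 ^ p) * U p ⊔ U p * Adeg K (2 ^ p)) := by
    have hVA : V p ≤ Adeg K (2 ^ p) := hsup ▸ le_sup_left
    calc Adeg K (2 ^ (p + 1)) = (V p ⊔ U p) * Adeg K (2 ^ p) := by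
          rw [hsup, Adeg_mul, pow_succ, mul_two]
      _ = V p * (V p ⊔ U p) ⊔ U p * Adeg K (2 ^ p) := by rw [Submodule.sup_mul, hsup]
      _ = V p * V p ⊔ (V p * U p ⊔ U p * Adeg K (2 ^ p)) := by rw [Submodule.mul_sup, sup_assoc]
      _ ≤ _ := sup_le_sup hVV (sup_le_sup (mul_le_mul' hVA le_rfl) le_rfl)
  intro x hx
  obtain ⟨z, hz, u, hu, rfl⟩ := Submodule.mem_sup.1 (hA (hUA hx))
  have : z ∈ V (p + 1) ⊓ U (p + 1) := ⟨hz, by simpa using sub_mem hx (hU hu)⟩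
  rw [hdisj, Submodule.mem_bot] at this
  simpa [this] using hu

theorem UVCond.mul_U_mul_le_of_dvd {U V : ℕ → Submodule K (FA K)} (hUV : UVCond K U V)
    {N : ℕ} {p P Q : ℕ} (hp : p ≤ N) (hP : 2 ^ p ∣ P) (hL : P + 2 ^ p + Q = 2 ^ (N + 1)) :
    Adeg K P * U p * Adeg K Q ≤ U N * Adeg K (2 ^ N) ⊔ Adeg K (2 ^ N) * U N := by
  induction hp using Nat.decreasingInduction generalizing P Q with
  | self =>
    obtain ⟨r, rfl⟩ := hP
    have hN : 0 < 2 ^ N := by positivity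
    have hr : r < 2 := by
      by_contra! h
      have := Nat.mul_le_mul_left (2 ^ N) h
      rw [pow_succ] at hL
      omega
    interval_cases r
    · obtain rfl : Q = 2 ^ N := by rw [pow_succ] at hL; omega
      rw [mul_zero, Adeg_zero, one_mul]
      exact le_sup_left
    · obtain rfl : Q = 0 := by rw [pow_succ] at hL; omega
      rw [mul_one, Adeg_zero, mul_one]
      exact le_sup_right
  | of_succ p hp ih =>
    obtain ⟨-, -, -, -, hU, -⟩ := hUV.2.2 (p + 1) (Nat.succ_pos p)
    rw [Nat.add_sub_cancel] at hU
    obtain ⟨r, rfl⟩ := hP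
    obtain ⟨q, rfl | rfl⟩ : ∃ q, r = 2 * q ∨ r = 2 * q + 1 := ⟨r / 2, by omega⟩
    · obtain ⟨t, rfl⟩ := Nat.exists_eq_add_of_lt hp
      have hq : q < 2 ^ (t + 1) := by
        by_contra! h
        have := Nat.mul_le_mul_left (2 ^ (p + 1)) h
        have hp : 0 < 2 ^ p := by positivity
        rw [← pow_add, show p + 1 + (t + 1) = p + t + 1 + 1 by ring, ← hL, pow_succ,
          mul_assoc] at this
        omega
      have hQ : 2 ^ p ≤ Q := by
        have := Nat.mul_le_mul_left (2 ^ (p + 1)) hq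
        rw [← pow_add, show p + 1 + (t + 1) = p + t + 1 + 1 by ring, ← hL, pow_succ,
          mul_assoc, Nat.mul_succ, mul_add] at this
        omega
      obtain ⟨Q, rfl⟩ := Nat.exists_eq_add_of_le hQ
      refine le_trans ?_ (ih (P := 2 ^ p * (2 * q)) (Q := Q) ⟨q, by ring⟩ (by rw [← hL]; ring))
      rw [← Adeg_mul, ← mul_assoc, mul_assoc (Adeg K _)]
      exact mul_le_mul' (mul_le_mul' le_rfl (le_sup_right.trans hU)) le_rfl
    · refine le_trans ?_ (ih (P := 2 ^ p * (2 * q)) (Q := Q) ⟨q, by ring⟩ (by rw [← hL]; ring))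
      rw [mul_add, mul_one, ← Adeg_mul, mul_assoc (Adeg K _)]
      exact mul_le_mul' (mul_le_mul' le_rfl (le_sup_left.trans hU)) le_rfl

theorem UVCond.mul_U_mul_le {U V : ℕ → Submodule K (FA K)} (hUV : UVCond K U V) {α : ℕ}
    (hdim : ∀ m, α ≤ m → Module.finrank K (V m) = 1) {N : ℕ} (hN : α ≤ N) {p P Q : ℕ}
    (hP : 2 ^ min p α ∣ P) (hL : P + 2 ^ p + Q = 2 ^ (N + 1)) :
    Adeg K P * U p * Adeg K Q ≤ U N * Adeg K (2 ^ N) ⊔ Adeg K (2 ^ N) * U N := by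
  obtain hp | hp := le_total p α
  · exact hUV.mul_U_mul_le_of_dvd (hp.trans hN) (by rwa [min_eq_left hp] at hP) hL
  rw [min_eq_right hp] at hP
  induction p, hp using Nat.le_induction generalizing P Q with
  | base => exact hUV.mul_U_mul_le_of_dvd hN hP hL
  | succ p hp ih =>
    have h := hUV.U_succ_le (hdim p hp) (hdim (p + 1) (by omega))
    refine (mul_le_mul' (mul_le_mul' le_rfl h) le_rfl).trans ?_
    rw [Submodule.mul_sup, Submodule.sup_mul]
    refine sup_le ?_ ?_
    · rw [← mul_assoc, Adeg_mul]
      exact ih (dvd_add hP (pow_dvd_pow 2 hp)) (by rw [← hL]; ring)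
    · rw [mul_assoc, mul_assoc, Adeg_mul, ← mul_assoc]
      exact ih hP (by rw [← hL]; ring)

/-- A multilinear map taking values in a submodule on tuples from a set also does so on tuples
from the span of that set. -/
theorem multilinear_mem_of_mem_span {R ι M N : Type*} [CommSemiring R] [AddCommMonoid M]
    [Module R M] [AddCommMonoid N] [Module R N] [Fintype ι]
    (f : MultilinearMap R (fun _ : ι => M) N) (S : Set M) (W : Submodule R N)
    (h : ∀ x : ι → M, (∀ i, x i ∈ S) → f x ∈ W) (x : ι → M)
    (hx : ∀ i, x i ∈ Submodule.span R S) : f x ∈ W := by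
  suffices H : ∀ (s : Finset ι) (x : ι → M), (∀ i ∈ s, x i ∈ Submodule.span R S) →
      (∀ i ∉ s, x i ∈ S) → f x ∈ W from
    H Finset.univ x (fun i _ => hx i) (fun i hi => absurd (Finset.mem_univ i) hi)
  intro s
  induction s using Finset.induction_on with
  | empty => exact fun x _ hx => h x fun i => hx i (Finset.notMem_empty i)
  | insert j s hj ih =>
    intro x hx hx'
    have key : ∀ y ∈ Submodule.span R S, f (Function.update x j y) ∈ W := by
      intro y hy
      induction hy using Submodule.span_induction with
      | mem y hy =>
        refine ih _ (fun i hi => ?_) (fun i hi => ?_)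
        · rw [Function.update_of_ne (by rintro rfl; exact hj hi)]
          exact hx i (Finset.mem_insert_of_mem hi)
        · by_cases e : i = j
          · subst e; simpa using hy
          · rw [Function.update_of_ne e]
            exact hx' i (by simp [e, hi])
      | zero => rw [f.map_update_zero]; exact W.zero_mem
      | add y z _ _ hy hz => rw [f.map_update_add]; exact W.add_mem hy hz
      | smul a y _ hy => rw [f.map_update_smul]; exact W.smul_mem a hy
    simpa using key (x j) (hx j (Finset.mem_insert_self j s))

/-- The homogeneous elements `x` of degree `k` such that `a x b ∈ W` whenever `a`, `b` are
homogeneous, `a x b` has degree `L`, and the degree of `a` is congruent to `s` modulo `M`. -/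
def slotKernel (W : Submodule K (FA K)) (L M s k : ℕ) : Submodule K (FA K) where
  carrier := {x | x ∈ Adeg K k ∧ ∀ P Q : ℕ, P ≡ s [MOD M] → P + k + Q = L →
    ∀ a ∈ Adeg K P, ∀ b ∈ Adeg K Q, a * x * b ∈ W}
  add_mem' := fun {x y} hx hy => ⟨add_mem hx.1 hy.1, fun P Q hP hL a ha b hb => by
    rw [mul_add, add_mul]
    exact add_mem (hx.2 P Q hP hL a ha b hb) (hy.2 P Q hP hL a ha b hb)⟩
  zero_mem' := ⟨zero_mem _, fun P Q hP hL a ha b hb => by simp⟩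
  smul_mem' := fun t x hx => ⟨Submodule.smul_mem _ t hx.1, fun P Q hP hL a ha b hb => by
    rw [mul_smul_comm, smul_mul_assoc]
    exact Submodule.smul_mem _ t (hx.2 P Q hP hL a ha b hb)⟩

section slotKernel

variable {W : Submodule K (FA K)} {L M : ℕ}

theorem Adeg_mul_slotKernel_le (s j k : ℕ) :
    Adeg K j * slotKernel W L M (s + j) k ≤ slotKernel W L M s (j + k) := by
  rw [Submodule.mul_le]
  intro y hy x hx
  refine ⟨mul_mem_Adeg hy hx.1, fun P Q hP hL a ha b hb => ?_⟩
  rw [← mul_assoc]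
  exact hx.2 (P + j) Q (hP.add_right j) (by omega) _ (mul_mem_Adeg ha hy) b hb

theorem slotKernel_mul_Adeg_le (s j k : ℕ) :
    slotKernel W L M s k * Adeg K j ≤ slotKernel W L M s (k + j) := by
  rw [Submodule.mul_le]
  intro x hx y hy
  refine ⟨mul_mem_Adeg hx.1 hy, fun P Q hP hL a ha b hb => ?_⟩
  rw [mul_assoc a, mul_assoc x, ← mul_assoc a]
  exact hx.2 P (j + Q) hP (by omega) a ha _ (mul_mem_Adeg hy hb)

/-- If `A(i) = V₁ + U₁` and `A(j) = V₂ + U₂` modulo the appropriate kernels, then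
`A(i+j) = V₁V₂` modulo the kernel. -/
theorem Adeg_add_le {i j s : ℕ} {V₁ V₂ : Submodule K (FA K)}
    (h₁ : Adeg K i ≤ V₁ ⊔ slotKernel W L M s i)
    (h₂ : Adeg K j ≤ V₂ ⊔ slotKernel W L M (s + i) j) :
    Adeg K (i + j) ≤ V₁ * V₂ ⊔ slotKernel W L M s (i + j) := by
  rw [← Adeg_mul, Submodule.mul_le]
  intro x hx y hy
  obtain ⟨v, hv, u, hu, rfl⟩ := Submodule.mem_sup.1 (h₁ hx)
  obtain ⟨v', hv', u', hu', rfl⟩ := Submodule.mem_sup.1 (h₂ hy)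
  have hvA : v ∈ Adeg K i := by simpa using sub_mem hx hu.1
  have hvA : v' ∈ Adeg K j := by simpa using sub_mem hy hu'.1
  rw [mul_add, add_mul, add_assoc]
  exact Submodule.add_mem_sup (Submodule.mul_mem_mul hv hv')
    (add_mem (slotKernel_mul_Adeg_le s j i (Submodule.mul_mem_mul hu hvA))
      (Adeg_mul_slotKernel_le s i j (Submodule.mul_mem_mul hx hu')))

variable {U V : ℕ → Submodule K (FA K)} {α : ℕ}

theorem Adeg_le_prodLow (hUV : UVCond K U V)
    (hG : ∀ p s, 2 ^ min p α ∣ s → U p ≤ slotKernel W L M s (2 ^ p)) (k i s : ℕ)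
    (hk : ∀ p, k.testBit p → 2 ^ min (i + p) α ∣ s + 2 ^ i * k) :
    Adeg K (2 ^ i * k) ≤ prodLow K V i k ⊔ slotKernel W L M s (2 ^ i * k) := by
  induction k using Nat.strong_induction_on generalizing i s with
  | _ k ih =>
  rw [prodLow]
  split_ifs with h0 h1
  · subst h0
    rw [mul_zero, Adeg_zero]
    exact le_sup_left
  · obtain ⟨q, rfl⟩ : ∃ q, k = 2 * q + 1 := ⟨k / 2, by omega⟩
    rw [show (2 * q + 1) / 2 = q by omega]
    have e : 2 ^ i * (2 * q + 1) = 2 ^ i + 2 ^ (i + 1) * q := by ring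
    rw [e] at hk ⊢
    refine Adeg_add_le ?_ (ih q (by omega) (i + 1) (s + 2 ^ i) fun p hp => ?_)
    · rw [← hUV.sup_eq]
      refine sup_le_sup le_rfl (hG i s ?_)
      have h := hk 0 (by simp)
      rw [add_zero, ← e] at h
      exact (Nat.dvd_add_left ((pow_dvd_pow 2 (min_le_left i α)).mul_right _)).1 h
    · have := hk (p + 1) (by rw [Nat.testBit_succ]; convert hp using 2; omega)
      rwa [show i + 1 + p = i + (p + 1) by ring, add_assoc]
  · obtain ⟨q, rfl⟩ : ∃ q, k = 2 * q := ⟨k / 2, by omega⟩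
    rw [show (2 * q) / 2 = q by omega, one_mul]
    have e : 2 ^ i * (2 * q) = 2 ^ (i + 1) * q := by ring
    rw [e] at hk ⊢
    refine ih q (by omega) (i + 1) s fun p hp => ?_
    have := hk (p + 1) (by rw [Nat.testBit_succ]; convert hp using 2; omega)
    rwa [show i + 1 + p = i + (p + 1) by ring]

theorem Adeg_le_prodHigh (hUV : UVCond K U V)
    (hG : ∀ p s, 2 ^ min p α ∣ s → U p ≤ slotKernel W L M s (2 ^ p)) (k i s : ℕ)
    (hk : ∀ p, k.testBit p → 2 ^ min (i + p) α ∣ s) :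
    Adeg K (2 ^ i * k) ≤ prodHigh K V i k ⊔ slotKernel W L M s (2 ^ i * k) := by
  induction k using Nat.strong_induction_on generalizing i with
  | _ k ih =>
  rw [prodHigh]
  split_ifs with h0 h1
  · subst h0
    rw [mul_zero, Adeg_zero]
    exact le_sup_left
  · obtain ⟨q, rfl⟩ : ∃ q, k = 2 * q + 1 := ⟨k / 2, by omega⟩
    rw [show (2 * q + 1) / 2 = q by omega]
    have e : 2 ^ i * (2 * q + 1) = 2 ^ (i + 1) * q + 2 ^ i := by ring
    rw [e]
    refine Adeg_add_le (ih q (by omega) (i + 1) fun p hp => ?_) ?_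
    · have := hk (p + 1) (by rw [Nat.testBit_succ]; convert hp using 2; omega)
      rwa [show i + 1 + p = i + (p + 1) by ring]
    · rw [← hUV.sup_eq]
      refine sup_le_sup le_rfl (hG i _ (dvd_add (by simpa using hk 0 (by simp)) ?_))
      exact (pow_dvd_pow 2 ((min_le_left i α).trans i.le_succ)).mul_right _
  · obtain ⟨q, rfl⟩ : ∃ q, k = 2 * q := ⟨k / 2, by omega⟩
    rw [show (2 * q) / 2 = q by omega, mul_one]
    have e : 2 ^ i * (2 * q) = 2 ^ (i + 1) * q := by ring
    rw [e]
    refine ih q (by omega) (i + 1) fun p hp => ?_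
    have := hk (p + 1) (by rw [Nat.testBit_succ]; convert hp using 2; omega)
    rwa [show i + 1 + p = i + (p + 1) by ring]

/-- An interval of integers has a point that is, up to level `α`, at least as divisible by `2` as
the dyadic pieces into which it cuts the interval. -/
theorem exists_dyadic_cut (α s n : ℕ) : ∃ i ≤ n,
    (∀ p, i.testBit p → 2 ^ min p α ∣ s + i) ∧
      ∀ p, (n - i).testBit p → 2 ^ min p α ∣ s + i := by
  induction α with
  | zero => exact ⟨0, Nat.zero_le n, by simp, by simp⟩
  | succ α ih =>
    by_cases h : ∃ i ≤ n, 2 ^ (α + 1) ∣ s + i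
    · obtain ⟨i, hi, hd⟩ := h
      have (p : ℕ) : 2 ^ min p (α + 1) ∣ s + i := (pow_dvd_pow 2 (min_le_right _ _)).trans hd
      exact ⟨i, hi, fun p _ => this p, fun p _ => this p⟩
    · push Not at h
      obtain ⟨i, hi, h₁, h₂⟩ := ih
      have key (j p : ℕ) (hj : j.testBit p) (hd : 2 ^ min p α ∣ s + i)
          (hadd : j ≤ i ∨ j ≤ n - i) : 2 ^ min p (α + 1) ∣ s + i := by
        obtain hp | hp := le_or_gt p α
        · rwa [min_eq_left (hp.trans α.le_succ), ← min_eq_left hp]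
        rw [min_eq_right hp.le] at hd
        obtain ⟨r, hr⟩ := hd
        obtain ⟨q, rfl | rfl⟩ : ∃ q, r = 2 * q ∨ r = 2 * q + 1 := ⟨r / 2, by omega⟩
        · exact absurd (hr ▸ ⟨q, by ring⟩) (h i hi)
        have hpj := (Nat.pow_le_pow_right two_pos hp.le).trans (Nat.ge_two_pow_of_testBit hj)
        rcases hadd with hadd | hadd
        · refine absurd ⟨q, ?_⟩ (h (i - 2 ^ α) ((Nat.sub_le _ _).trans hi))
          rw [← Nat.add_sub_assoc (hpj.trans hadd), hr, mul_add, mul_one, Nat.add_sub_cancel]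
          ring
        · refine absurd ⟨q + 1, ?_⟩ (h (i + 2 ^ α) (by omega))
          rw [← add_assoc, hr]
          ring
      exact ⟨i, hi, fun p hp => key i p hp (h₁ p hp) (.inl le_rfl),
        fun p hp => key _ p hp (h₂ p hp) (.inr le_rfl)⟩

theorem exists_Adeg_le_Vlt_mul_Vgt (hUV : UVCond K U V)
    (hG : ∀ p s, 2 ^ min p α ∣ s → U p ≤ slotKernel W L M s (2 ^ p)) (n s : ℕ) :
    ∃ i ≤ n, Adeg K n ≤ Vlt K V i * Vgt K V (n - i) ⊔ slotKernel W L M s n := by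
  obtain ⟨i, hi, h₁, h₂⟩ := exists_dyadic_cut α s n
  have hlow := Adeg_le_prodLow hUV hG i 0 s (by simpa using h₁)
  have hhigh := Adeg_le_prodHigh hUV hG (n - i) 0 (s + i) (by simpa using h₂)
  rw [pow_zero, one_mul] at hlow hhigh
  refine ⟨i, hi, ?_⟩
  have := Adeg_add_le hlow hhigh
  rwa [Nat.add_sub_cancel' hi] at this

end slotKernel

/-- A Capelli polynomial as an alternating map in its first group of variables. -/
theorem capelli_eq_alternatization {β : ℕ} (m r : Fin β → FA K) :
    capelli β m r = MultilinearMap.alternatization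
      ((MultilinearMap.mkPiAlgebraFin K β (FA K)).compLinearMap
        fun i => LinearMap.mulRight K (r i)) m := by
  rw [MultilinearMap.alternatization_apply, capelli]
  refine Finset.sum_congr rfl fun σ _ => ?_
  rw [Units.smul_def]
  simp [MultilinearMap.domDomCongr_apply, List.ofFn_eq_map]

/-- A product with a factor from `slotKernel` in the right position lies in `W`. -/
theorem mul_prod_mul_mem {W : Submodule K (FA K)} {L M s n β P Q : ℕ} {x r : Fin β → FA K}
    {d : Fin β → ℕ} (hx : ∀ i, x i ∈ Adeg K n) (hr : ∀ i, r i ∈ Adeg K (d i)) {u v : FA K}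
    (hu : u ∈ Adeg K P) (hv : v ∈ Adeg K Q)
    (hL : P + ((List.finRange β).map fun i => n + d i).sum + Q = L) (j : Fin β)
    (hj : P + (((List.finRange β).take j).map fun i => n + d i).sum ≡ s [MOD M])
    (hxj : x j ∈ slotKernel W L M s n) :
    u * ((List.finRange β).map fun i => x i * r i).prod * v ∈ W := by
  have hlt : (j : ℕ) < (List.finRange β).length := by simp
  have hsplit : List.finRange β =
      (List.finRange β).take j ++ j :: (List.finRange β).drop (j + 1) := by
    conv_lhs => rw [← List.take_append_drop j (List.finRange β), List.drop_eq_getElem_cons hlt]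
    simp
  have hdeg (l : List (Fin β)) := list_prod_mem_Adeg l (fun i => x i * r i) (fun i => n + d i)
    fun i => mul_mem_Adeg (hx i) (hr i)
  rw [hsplit] at hL ⊢
  simp only [List.map_append, List.map_cons, List.prod_append, List.prod_cons, List.sum_append,
    List.sum_cons] at hL ⊢
  have := hxj.2 _ _ hj (by rw [← hL]; ring) _ (mul_mem_Adeg hu (hdeg _)) _
    (mul_mem_Adeg (mul_mem_Adeg (hr j) (hdeg ((List.finRange β).drop (j + 1)))) hv)
  simpa only [mul_assoc] using this

/-- A Capelli polynomial vanishes modulo `W` when more than `c` of its slots have the same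
kernel and that kernel has codimension at most `c`. -/
theorem mul_capelli_mul_mem {W : Submodule K (FA K)} {L M s n β P Q c : ℕ}
    {m r : Fin β → FA K} {d : Fin β → ℕ}
    (hm : ∀ i, m i ∈ Adeg K n) (hr : ∀ i, r i ∈ Adeg K (d i)) {u v : FA K}
    (hu : u ∈ Adeg K P) (hv : v ∈ Adeg K Q)
    (hL : P + ((List.finRange β).map fun i => n + d i).sum + Q = L) (J : Finset (Fin β))
    (hJ : ∀ j ∈ J, P + (((List.finRange β).take j).map fun i => n + d i).sum ≡ s [MOD M])
    (hcard : c < J.card) {T : Submodule K (FA K)} (hT : Module.rank K T ≤ c)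
    (hA : Adeg K n ≤ T ⊔ slotKernel W L M s n) :
    u * capelli β m r * v ∈ W := by
  have hT' : Module.rank K ↥(T ⊓ Adeg K n) ≤ c := (Submodule.rank_mono inf_le_left).trans hT
  have : FiniteDimensional K ↥(T ⊓ Adeg K n) :=
    Module.rank_lt_aleph0_iff.1 (hT'.trans_lt (Cardinal.natCast_lt_aleph0))
  set k := Module.finrank K ↥(T ⊓ Adeg K n)
  have hk : k ≤ c := Module.finrank_le_of_rank_le hT'
  let e : Fin k → FA K := fun i => (Module.finBasis K ↥(T ⊓ Adeg K n) i : FA K)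
  have he : Submodule.span K (Set.range e) = T ⊓ Adeg K n := by
    have := congrArg (Submodule.map (T ⊓ Adeg K n).subtype)
      (Module.finBasis K ↥(T ⊓ Adeg K n)).span_eq
    rwa [Submodule.map_span, Submodule.map_subtype_top, ← Set.range_comp] at this
  have heA (i : Fin k) : e i ∈ Adeg K n := (Module.finBasis K ↥(T ⊓ Adeg K n) i).2.2
  let S : Set (FA K) := Set.range e ∪ slotKernel W L M s n
  have hSA : ∀ x ∈ S, x ∈ Adeg K n := by
    rintro x (⟨i, rfl⟩ | hx)
    · exact heA i
    · exact hx.1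
  have hmS (i : Fin β) : m i ∈ Submodule.span K S := by
    rw [Submodule.span_union, he, Submodule.span_eq]
    obtain ⟨t, ht, g, hg, htg⟩ := Submodule.mem_sup.1 (hA (hm i))
    have : t ∈ Adeg K n := by
      rw [eq_sub_of_add_eq htg]
      exact sub_mem (hm i) hg.1
    exact htg ▸ Submodule.add_mem_sup ⟨ht, this⟩ hg
  rw [capelli_eq_alternatization]
  refine multilinear_mem_of_mem_span (AlternatingMap.toMultilinearMap _) S
    (W.comap (LinearMap.mulRight K v ∘ₗ LinearMap.mulLeft K u)) (fun x hx => ?_) m hmS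
  change u * MultilinearMap.alternatization _ x * v ∈ W
  by_cases hinj : Set.InjOn x {i | x i ∈ Set.range e}
  · rw [← capelli_eq_alternatization, capelli, Finset.mul_sum, Finset.sum_mul]
    refine sum_mem fun σ _ => ?_
    rw [mul_smul_comm, smul_mul_assoc]
    refine zsmul_mem ?_ _
    obtain ⟨j, hjJ, hj⟩ : ∃ j ∈ J, x (σ j) ∉ Set.range e := by
      by_contra! h
      refine hcard.not_ge (le_trans ?_ hk)
      have := Finset.card_le_card_of_injOn (s := J) (t := Finset.univ.image e) (fun j => x (σ j))
        (fun j hj => by simpa using h j hj)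
        (fun i hi j hj hij => σ.injective (hinj (h i hi) (h j hj) hij))
      exact this.trans (Finset.card_image_le.trans (by simp))
    exact mul_prod_mul_mem (x := fun i => x (σ i)) (fun i => hSA _ (hx _)) hr hu hv hL j
      (hJ j hjJ) ((hx (σ j)).resolve_left hj)
  · obtain ⟨i, -, j, -, hij, hne⟩ : ∃ i, x i ∈ Set.range e ∧ ∃ j, x j ∈ Set.range e ∧
        x i = x j ∧ i ≠ j := by
      simpa [Set.InjOn, and_assoc] using hinj
    rw [AlternatingMap.map_eq_zero_of_eq _ x hij hne]
    simp

theorem capelli_mem_Adeg {n β : ℕ} {m r : Fin β → FA K} {d : Fin β → ℕ}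
    (hm : ∀ i, m i ∈ Adeg K n) (hr : ∀ i, r i ∈ Adeg K (d i)) :
    capelli β m r ∈ Adeg K ((List.finRange β).map fun i => n + d i).sum :=
  sum_mem fun σ _ => zsmul_mem (list_prod_mem_Adeg (List.finRange β) (fun i => m (σ i) * r i)
    (fun i => n + d i) fun i => mul_mem_Adeg (hm _) (hr i)) _

end

/-- **Lemma 2.3.**  For `β > 2^α(c+1)`, Capelli polynomials of size `β` in monomials of a
common degree `n`, with arbitrary monomial separators, lie in `E`. -/
theorem statement8 (U V : ℕ → Submodule K (FA K)) (hUV : UVCond K U V)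
    (α : ℕ) (hα : 1 ≤ α) (hdim : ∀ m, α ≤ m → Module.finrank K (V m) = 1)
    (c : ℕ)
    (hc : ∀ n : ℕ,
      Module.rank K ↥(⨆ i ∈ Finset.range (n + 1), Vlt K V i * Vgt K V (n - i)) ≤
        (c : Cardinal))
    (β : ℕ) (hβ : 2 ^ α * (c + 1) < β)
    (n : ℕ) (hn : 1 ≤ n)
    (m : Fin β → FA K) (hm : ∀ i, m i ∈ Mon K n)
    (r : Fin β → FA K) (hrmon : ∀ i, ∃ dᵢ : ℕ, r i ∈ Mon K dᵢ) :
    capelli β m r ∈ Esub K U := by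
  choose d hr using hrmon
  replace hm (i : Fin β) : m i ∈ Adeg K n := Submodule.subset_span (hm i)
  replace hr (i : Fin β) : r i ∈ Adeg K (d i) := Submodule.subset_span (hr i)
  set D := ((List.finRange β).map fun i => n + d i).sum with hD
  have hβD : β ≤ D := by
    have := List.sum_le_sum (l := List.finRange β) (f := fun _ => 1) (g := fun i => n + d i)
      fun i _ => hn.trans (Nat.le_add_right _ _)
    simpa [hD] using this
  have hαD : 2 ^ α ≤ D := (Nat.le_mul_of_pos_right _ c.succ_pos).trans (hβ.le.trans hβD)
  have hD0 : D ≠ 0 := (Nat.two_pow_pos α |>.trans_le hαD).ne'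
  have hmem : capelli β m r ∈ Adeg K D := capelli_mem_Adeg hm hr
  refine Submodule.subset_span (Set.mem_iUnion₂.2 ⟨D, Nat.one_le_iff_ne_zero.2 hD0, hmem, ?_⟩)
  set N := Nat.log 2 D + 1
  have hαN : α ≤ N := (Nat.le_log_of_pow_le one_lt_two hαD).trans (Nat.le_succ _)
  refine ideal_inf_Adeg_le hmem _ fun P Q hL u hu v hv => ?_
  obtain ⟨s, -, hs⟩ := Finset.exists_lt_card_fiber_of_mul_lt_card_of_maps_to
    (s := (Finset.univ : Finset (Fin β))) (t := Finset.range (2 ^ α)) (n := c + 1)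
    (f := fun j => (P + (((List.finRange β).take j).map fun i => n + d i).sum) % 2 ^ α)
    (fun j _ => Finset.mem_range.2 (Nat.mod_lt _ (Nat.two_pow_pos α))) (by simpa using hβ)
  have hG (p s : ℕ) (hps : 2 ^ min p α ∣ s) : U p ≤ slotKernel
      (U N * Adeg K (2 ^ N) ⊔ Adeg K (2 ^ N) * U N) (2 ^ (N + 1)) (2 ^ α) s (2 ^ p) :=
    fun x hx => ⟨hUV.sup_eq p ▸ Submodule.mem_sup_right hx, fun P Q hP hL a ha b hb =>
      hUV.mul_U_mul_le hdim hαN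
        ((hP.dvd_iff (pow_dvd_pow 2 (min_le_right p α))).2 hps) hL
        (Submodule.mul_mem_mul (Submodule.mul_mem_mul ha hx) hb)⟩
  obtain ⟨i, hi, hA⟩ := exists_Adeg_le_Vlt_mul_Vgt hUV hG n s
  have hT : Module.rank K ↥(Vlt K V i * Vgt K V (n - i)) ≤ c :=
    (Submodule.rank_mono (le_iSup₂_of_le (f := fun i _ => Vlt K V i * Vgt K V (n - i)) i
      (Finset.mem_range.2 (Nat.lt_succ_of_le hi)) le_rfl)).trans (hc n)
  refine mul_capelli_mul_mem hm hr (Submodule.subset_span hu) (Submodule.subset_span hv) hL _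
    (fun j hj => ?_) (Nat.lt_of_succ_lt hs) hT hA
  rw [Nat.ModEq, ← (Finset.mem_filter.1 hj).2, Nat.mod_mod]

end
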